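/- Let G be a free group with free basis a₁, …, aₙ, let H be a free group of rank greater than 1, let φ, ψ : G → H be homomorphisms, and let u, v ∈ H. Let φ̄ = φ*u*v : G*ℤ*ℤ → H be the homomorphism on the free group with basis a₁,…,aₙ,b₁,b₂ sending aᵢ ↦ aᵢφ, b₁ ↦ u, b₂ ↦ v. If φ̄ has remnant and |Rem_φ̄(aᵢ)| ≥ |aᵢψ| for every i ∈ {1,…,n}, then u and v are not doubly-twisted conjugate: there is no z ∈ G with zψ = u⁻¹·(zφ)·v. -/

import Mathlib

/-- The number of letters cancelled in the product `u * v` of elements of a free group: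
`c(u,v) = (|u| + |v| - |uv|)/2`. -/
def cancel {κ : Type*} [DecidableEq κ] (u v : FreeGroup κ) : ℕ :=
  (FreeGroup.norm u + FreeGroup.norm v - FreeGroup.norm (u * v)) / 2

/-- The basis letter indexed by `(i, ε)`: `of i` if `ε = true`, `(of i)⁻¹` if `ε = false`. -/
def bLetter {ι : Type*} (p : ι × Bool) : FreeGroup ι :=
  cond p.2 (FreeGroup.of p.1) (FreeGroup.of p.1)⁻¹

/-- `P_χ(x_i)`: maximal cancellation of `x_iχ` with the image of a basis letter `b ≠ x_i⁻¹`
multiplied on the left. -/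
def Pc {ι κ : Type*} [Fintype ι] [DecidableEq ι] [DecidableEq κ]
    (χ : FreeGroup ι →* FreeGroup κ) (i : ι) : ℕ :=
  (Finset.univ.erase (i, false)).sup fun p => cancel (χ (bLetter p)) (χ (FreeGroup.of i))

/-- `S_χ(x_i)`: maximal cancellation of `x_iχ` with the image of a basis letter `b ≠ x_i⁻¹`
multiplied on the right. -/
def Sc {ι κ : Type*} [Fintype ι] [DecidableEq ι] [DecidableEq κ]
    (χ : FreeGroup ι →* FreeGroup κ) (i : ι) : ℕ :=
  (Finset.univ.erase (i, false)).sup fun p => cancel (χ (FreeGroup.of i)) (χ (bLetter p))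

/-- `χ` has remnant if for every basis element a nontrivial subword of its image survives
all the cancellations: `P_χ(x_i) + S_χ(x_i) < |x_iχ|`. -/
def HasRemnant {ι κ : Type*} [Fintype ι] [DecidableEq ι] [DecidableEq κ]
    (χ : FreeGroup ι →* FreeGroup κ) : Prop :=
  ∀ i : ι, Pc χ i + Sc χ i < FreeGroup.norm (χ (FreeGroup.of i))

/-- The remnant length `|Rem_χ(x_i)| = |x_iχ| - P_χ(x_i) - S_χ(x_i)`. -/
def RemLen {ι κ : Type*} [Fintype ι] [DecidableEq ι] [DecidableEq κ]
    (χ : FreeGroup ι →* FreeGroup κ) (i : ι) : ℕ :=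
  FreeGroup.norm (χ (FreeGroup.of i)) - Pc χ i - Sc χ i

/-- The length of the longest common prefix of two lists. -/
def List.lcpLength {α : Type*} [DecidableEq α] : List α → List α → ℕ
  | a :: l, b :: m => if a = b then lcpLength l m + 1 else 0
  | _, _ => 0

theorem List.min_lcpLength_le {α : Type*} [DecidableEq α] (l₁ l₂ l₃ : List α) :
    min (l₁.lcpLength l₂) (l₂.lcpLength l₃) ≤ l₁.lcpLength l₃ := by
  induction l₁ generalizing l₂ l₃ with
  | nil => simp [List.lcpLength]
  | cons a l ih =>
    rcases l₂ with _ | ⟨b, m⟩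
    · simp [List.lcpLength]
    rcases l₃ with _ | ⟨c, k⟩
    · simp [List.lcpLength]
    have := ih m k
    simp only [List.lcpLength]
    split_ifs <;> first | omega | simp_all

theorem FreeGroup.IsReduced.of_cons {κ : Type*} {a : κ × Bool} {l : List (κ × Bool)}
    (h : FreeGroup.IsReduced (a :: l)) : FreeGroup.IsReduced l :=
  h.infix ⟨[a], [], by simp⟩

section Cancellation

variable {κ : Type*} [DecidableEq κ]

theorem FreeGroup.IsReduced.invRev {l : List (κ × Bool)} (h : FreeGroup.IsReduced l) :
    FreeGroup.IsReduced (FreeGroup.invRev l) := by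
  rw [FreeGroup.isReduced_iff_reduce_eq, FreeGroup.reduce_invRev, h.reduce_eq]

theorem FreeGroup.IsReduced.norm_mk {l : List (κ × Bool)} (h : FreeGroup.IsReduced l) :
    FreeGroup.norm (FreeGroup.mk l) = l.length := by
  rw [FreeGroup.norm, FreeGroup.toWord_mk, h.reduce_eq]

theorem FreeGroup.norm_inv_mk_mul_mk {l m : List (κ × Bool)}
    (hl : FreeGroup.IsReduced l) (hm : FreeGroup.IsReduced m) :
    FreeGroup.norm ((FreeGroup.mk l)⁻¹ * FreeGroup.mk m) + 2 * l.lcpLength m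
      = l.length + m.length := by
  induction l generalizing m with
  | nil => simp [List.lcpLength, ← FreeGroup.one_eq_mk, hm.norm_mk]
  | cons a l ih =>
    rcases m with _ | ⟨b, m⟩
    · simp [List.lcpLength, ← FreeGroup.one_eq_mk, hl.norm_mk, -FreeGroup.inv_mk]
    by_cases hab : a = b
    · subst hab
      have h := ih hl.of_cons hm.of_cons
      have e : (FreeGroup.mk (a :: l))⁻¹ * FreeGroup.mk (a :: m)
          = (FreeGroup.mk l)⁻¹ * FreeGroup.mk m := by
        rw [← List.singleton_append, ← List.singleton_append (l := m), ← FreeGroup.mul_mk,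
          ← FreeGroup.mul_mk]
        group
      simp only [e, List.lcpLength, if_true, List.length_cons]
      omega
    · have hr : FreeGroup.IsReduced (FreeGroup.invRev (a :: l) ++ b :: m) := by
        have h₁ := hl.invRev
        rw [FreeGroup.invRev_cons] at h₁ ⊢
        refine h₁.append_overlap ?_ (by simp [FreeGroup.invRev])
        simp only [FreeGroup.invRev, List.map_cons, List.map_nil, List.reverse_singleton,
          List.singleton_append, FreeGroup.isReduced_cons_cons]
        refine ⟨fun h => ?_, hm⟩
        have : a.2 ≠ b.2 := fun h' => hab (Prod.ext h h')
        revert this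
        cases a.2 <;> cases b.2 <;> simp
      rw [FreeGroup.inv_mk, FreeGroup.mul_mk, hr.norm_mk]
      simp [List.lcpLength, hab]

theorem norm_inv_mul_add_lcpLength (x y : FreeGroup κ) :
    FreeGroup.norm (x⁻¹ * y) + 2 * x.toWord.lcpLength y.toWord
      = FreeGroup.norm x + FreeGroup.norm y := by
  have := FreeGroup.norm_inv_mk_mul_mk (FreeGroup.isReduced_toWord (x := x))
    (FreeGroup.isReduced_toWord (x := y))
  rwa [FreeGroup.mk_toWord, FreeGroup.mk_toWord] at this

theorem cancel_inv_left (x y : FreeGroup κ) :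
    cancel x⁻¹ y = x.toWord.lcpLength y.toWord := by
  have := norm_inv_mul_add_lcpLength x y
  simp only [cancel, FreeGroup.norm_inv_eq]
  omega

theorem norm_mul_add_cancel (x y : FreeGroup κ) :
    FreeGroup.norm (x * y) + 2 * cancel x y = FreeGroup.norm x + FreeGroup.norm y := by
  have := norm_inv_mul_add_lcpLength x⁻¹ y
  rwa [← cancel_inv_left, inv_inv, FreeGroup.norm_inv_eq] at this

/-- The tree property of free groups: the Gromov product `(x, y) ↦ cancel x⁻¹ y` is
`0`-hyperbolic. -/
theorem min_cancel_le (x y z : FreeGroup κ) :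
    min (cancel x y) (cancel y⁻¹ z) ≤ cancel x z := by
  rw [← inv_inv x]
  simp only [cancel_inv_left x⁻¹, cancel_inv_left y]
  exact List.min_lcpLength_le _ _ _

theorem cancel_inv_inv (x y : FreeGroup κ) : cancel y⁻¹ x⁻¹ = cancel x y := by
  rw [cancel, cancel, ← mul_inv_rev]
  simp only [FreeGroup.norm_inv_eq, add_comm]

theorem cancel_inv_comm (x y : FreeGroup κ) : cancel y⁻¹ x = cancel x⁻¹ y := by
  rw [← cancel_inv_inv x⁻¹ y, inv_inv]

end Cancellation

section Remnant

variable {ι κ : Type*}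

theorem bLetter_inv (p : ι × Bool) : bLetter (p.1, !p.2) = (bLetter p)⁻¹ := by
  rcases p with ⟨i, _ | _⟩ <;> simp [bLetter]

theorem mk_cons_eq_bLetter_mul (p : ι × Bool) (w : List (ι × Bool)) :
    FreeGroup.mk (p :: w) = bLetter p * FreeGroup.mk w := by
  rw [← List.singleton_append, ← FreeGroup.mul_mk]
  rcases p with ⟨i, _ | _⟩ <;> rfl

variable [Fintype ι] [DecidableEq ι] [DecidableEq κ]

/-- The maximal cancellation at the left end of the image of a basis letter. -/
def leftCancel (χ : FreeGroup ι →* FreeGroup κ) (p : ι × Bool) : ℕ :=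
  cond p.2 (Pc χ p.1) (Sc χ p.1)

theorem cancel_le_leftCancel (χ : FreeGroup ι →* FreeGroup κ) {b p : ι × Bool}
    (h : b ≠ (p.1, !p.2)) :
    cancel (χ (bLetter b)) (χ (bLetter p)) ≤ leftCancel χ p := by
  rcases p with ⟨i, _ | _⟩
  · have hb : (b.1, !b.2) ∈ Finset.univ.erase (i, false) := by
      rcases b with ⟨j, _ | _⟩ <;> simp_all
    rw [← cancel_inv_inv, ← map_inv, ← map_inv, ← bLetter_inv, ← bLetter_inv]
    exact Finset.le_sup
      (f := fun q => cancel (χ (FreeGroup.of i)) (χ (bLetter q))) hb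
  · have hb : b ∈ Finset.univ.erase (i, false) := by simpa using h
    exact Finset.le_sup
      (f := fun q => cancel (χ (bLetter q)) (χ (FreeGroup.of i))) hb

theorem cancel_le_leftCancel_inv (χ : FreeGroup ι →* FreeGroup κ) {b p : ι × Bool}
    (h : b ≠ (p.1, !p.2)) :
    cancel (χ (bLetter b)) (χ (bLetter p)) ≤ leftCancel χ (b.1, !b.2) := by
  rw [← cancel_inv_inv, ← map_inv, ← map_inv, ← bLetter_inv, ← bLetter_inv]
  refine cancel_le_leftCancel χ fun h' => h ?_
  rcases b with ⟨j, _ | _⟩ <;> rcases p with ⟨i, _ | _⟩ <;> simp_all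

variable {χ : FreeGroup ι →* FreeGroup κ}

theorem HasRemnant.remLen_pos (hχ : HasRemnant χ) (i : ι) : 0 < RemLen χ i := by
  have := hχ i
  simp only [RemLen]
  omega

theorem HasRemnant.norm_bLetter (hχ : HasRemnant χ) (p : ι × Bool) :
    FreeGroup.norm (χ (bLetter p))
      = leftCancel χ p + RemLen χ p.1 + leftCancel χ (p.1, !p.2) := by
  have := hχ p.1
  rcases p with ⟨i, _ | _⟩ <;>
    simp only [RemLen, leftCancel, bLetter, cond_true, cond_false, map_inv,
      FreeGroup.norm_inv_eq, Bool.not_true, Bool.not_false] at this ⊢ <;>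
    omega

/-- If `y` agrees with the image of the letter `p` on a prefix containing the remnant, then the
image of a letter `b ≠ p⁻¹` cancels against `y` no more than against the image of `p`. -/
theorem HasRemnant.cancel_le_cancel (hχ : HasRemnant χ) {b p : ι × Bool} (h : b ≠ (p.1, !p.2))
    {y : FreeGroup κ}
    (hy : FreeGroup.norm (χ (bLetter p))
      ≤ cancel (χ (bLetter p))⁻¹ y + leftCancel χ (p.1, !p.2)) :
    cancel (χ (bLetter b)) y ≤ cancel (χ (bLetter b)) (χ (bLetter p)) := by
  have h₁ := min_cancel_le (χ (bLetter b)) y (χ (bLetter p))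
  have h₂ := cancel_le_leftCancel χ h
  have h₃ := hχ.norm_bLetter p
  have h₄ := hχ.remLen_pos p.1
  rw [cancel_inv_comm] at h₁
  omega

theorem HasRemnant.norm_map_mk_cons (hχ : HasRemnant χ) (w : List (ι × Bool)) (p : ι × Bool)
    (hw : FreeGroup.IsReduced (p :: w)) :
    leftCancel χ p + ((p :: w).map fun q => RemLen χ q.1).sum
        ≤ FreeGroup.norm (χ (FreeGroup.mk (p :: w))) ∧
      FreeGroup.norm (χ (bLetter p))
        ≤ cancel (χ (bLetter p))⁻¹ (χ (FreeGroup.mk (p :: w))) + leftCancel χ (p.1, !p.2) := by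
  induction w generalizing p with
  | nil =>
    have h₁ := hχ.norm_bLetter p
    have h₂ := norm_mul_add_cancel (χ (bLetter p))⁻¹ (χ (bLetter p))
    rw [inv_mul_cancel, FreeGroup.norm_one, FreeGroup.norm_inv_eq] at h₂
    rw [mk_cons_eq_bLetter_mul, ← FreeGroup.one_eq_mk, mul_one]
    simp only [List.map_cons, List.map_nil, List.sum_cons, List.sum_nil]
    omega
  | cons q w ih =>
    rw [FreeGroup.isReduced_cons_cons] at hw
    obtain ⟨h₁, h₂⟩ := ih q hw.2
    have hpq : p ≠ (q.1, !q.2) := by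
      rintro rfl
      simpa using hw.1 rfl
    have h₃ := hχ.cancel_le_cancel hpq h₂
    have h₄ := cancel_le_leftCancel χ hpq
    have h₅ := cancel_le_leftCancel_inv χ hpq
    have h₆ := hχ.norm_bLetter p
    rw [mk_cons_eq_bLetter_mul p, map_mul]
    have h₇ := norm_mul_add_cancel (χ (bLetter p)) (χ (FreeGroup.mk (q :: w)))
    have h₈ := norm_mul_add_cancel (χ (bLetter p))⁻¹
      (χ (bLetter p) * χ (FreeGroup.mk (q :: w)))
    rw [inv_mul_cancel_left, FreeGroup.norm_inv_eq] at h₈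
    rw [List.map_cons, List.sum_cons]
    omega

/-- The remnants of the letters of a reduced word survive in the image of that word. -/
theorem HasRemnant.sum_remLen_le_norm (hχ : HasRemnant χ) {w : List (ι × Bool)}
    (hw : FreeGroup.IsReduced w) :
    (w.map fun q => RemLen χ q.1).sum ≤ FreeGroup.norm (χ (FreeGroup.mk w)) := by
  rcases w with _ | ⟨p, w⟩
  · simp
  · exact le_of_add_le_right (hχ.norm_map_mk_cons w p hw).1

end Remnant

theorem norm_map_mk_le_sum {ι κ : Type*} [DecidableEq κ] (ψ : FreeGroup ι →* FreeGroup κ)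
    {r : ι → ℕ} (hr : ∀ i, FreeGroup.norm (ψ (FreeGroup.of i)) ≤ r i) (w : List (ι × Bool)) :
    FreeGroup.norm (ψ (FreeGroup.mk w)) ≤ (w.map fun q => r q.1).sum := by
  induction w with
  | nil => simp [← FreeGroup.one_eq_mk]
  | cons p w ih =>
    rw [mk_cons_eq_bLetter_mul, map_mul, List.map_cons, List.sum_cons]
    refine (FreeGroup.norm_mul_le _ _).trans (add_le_add ?_ ih)
    rcases p with ⟨i, _ | _⟩
    · simpa [bLetter] using hr i
    · exact hr i

/-- Staecker's remnant inequality criterion: let `φ̄ = φ*u*v : G*ℤ*ℤ → H` (sending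
`aᵢ ↦ aᵢφ`, `b₁ ↦ u`, `b₂ ↦ v`), where `H` has rank `> 1`. If `φ̄` has remnant and
`|Rem_φ̄(aᵢ)| ≥ |aᵢψ|` for every `i`, then `u` and `v` are not doubly-twisted conjugate:
there is no `z ∈ G` with `zψ = u⁻¹(zφ)v`. -/
theorem not_doubly_twisted_of_remnant_inequality {n : ℕ} {κ : Type*}
    [DecidableEq κ] [Nontrivial κ]
    (φ ψ : FreeGroup (Fin n) →* FreeGroup κ) (u v : FreeGroup κ)
    (φbar : FreeGroup (Fin n ⊕ Bool) →* FreeGroup κ)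
    (hφbar : φbar = FreeGroup.lift (Sum.elim (fun i => φ (FreeGroup.of i))
        (fun b => cond b v u)))
    (hrem : HasRemnant φbar)
    (hlen : ∀ i : Fin n, FreeGroup.norm (ψ (FreeGroup.of i)) ≤ RemLen φbar (Sum.inl i)) :
    ¬ ∃ z : FreeGroup (Fin n), ψ z = u⁻¹ * φ z * v := by
  rintro ⟨z, hz⟩
  set w : List ((Fin n ⊕ Bool) × Bool) :=
    (Sum.inr false, false) ::
      (z.toWord.map (fun q => (Sum.inl q.1, q.2)) ++ [(Sum.inr true, true)]) with hw
  have hw_red : FreeGroup.IsReduced w := by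
    have hz_red : FreeGroup.IsReduced
        (z.toWord.map fun q => ((Sum.inl q.1 : Fin n ⊕ Bool), q.2)) := by
      rw [FreeGroup.IsReduced, List.isChain_map]
      simpa [FreeGroup.IsReduced] using FreeGroup.isReduced_toWord (x := z)
    rw [hw, FreeGroup.IsReduced, List.isChain_cons, List.isChain_append]
    refine ⟨?_, hz_red, List.isChain_singleton _, ?_⟩
    · cases z.toWord <;> simp
    · intro a ha b hb
      obtain ⟨q, -, rfl⟩ := List.mem_map.1 (List.mem_of_mem_getLast? ha)
      simp only [List.head?_cons, Option.mem_def, Option.some.injEq] at hb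
      subst hb
      simp
  have hinl : φbar.comp (FreeGroup.map Sum.inl) = φ := by
    ext i
    simp [hφbar]
  have hw_map : φbar (FreeGroup.mk w) = ψ z := by
    have hz_map : φbar (FreeGroup.mk (z.toWord.map fun q => (Sum.inl q.1, q.2))) = φ z := by
      rw [← hinl, MonoidHom.comp_apply, ← FreeGroup.map.mk, FreeGroup.mk_toWord]
    rw [hw, mk_cons_eq_bLetter_mul, ← FreeGroup.mul_mk, map_mul, map_mul, hz_map,
      mk_cons_eq_bLetter_mul, ← FreeGroup.one_eq_mk, mul_one, hz]
    simp [hφbar, bLetter, mul_assoc]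
  have h₁ := hrem.sum_remLen_le_norm hw_red
  have h₂ := norm_map_mk_le_sum ψ hlen z.toWord
  have h₃ := hrem.remLen_pos (Sum.inr false)
  rw [FreeGroup.mk_toWord] at h₂
  rw [hw_map, hw] at h₁
  simp only [List.map_cons, List.map_append, List.map_map, List.map_nil, List.sum_cons,
    List.sum_append, List.sum_nil, Function.comp_def] at h₁
  omega
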